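/- There is a constant C > 0 such that for every ω ≥ 1 and every Schwartz function f on ℝ³ = ℝ² × ℝ (variables (x,z)), one has ‖∇f‖_{L⁶(ℝ³)} ≤ C ω^{2/3} ‖S²f‖_{L²(ℝ³)}, where S²f = (1−ω) f − Δ f + ω² z² f. -/

import Mathlib

open MeasureTheory Complex

noncomputable section

/-- ℝ² with the Euclidean norm. -/
abbrev R2 : Type := EuclideanSpace ℝ (Fin 2)

/-- ℝ³ written as ℝ² × ℝ, points r = (x, z). -/
abbrev R3 : Type := R2 × ℝ

/-- Directional derivative of `f` at `p` in the direction `v`. -/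
def pd {E F : Type*} [NormedAddCommGroup E] [NormedSpace ℝ E]
    [NormedAddCommGroup F] [NormedSpace ℝ F] (v : E) (f : E → F) (p : E) : F :=
  fderiv ℝ f p v

/-- Second directional derivative in the direction `v`. -/
def pd2 {E F : Type*} [NormedAddCommGroup E] [NormedSpace ℝ E]
    [NormedAddCommGroup F] [NormedSpace ℝ F] (v : E) (f : E → F) (p : E) : F :=
  pd v (pd v f) p

/-- First coordinate direction in the x-plane. -/
def ex0 : R3 := (EuclideanSpace.single 0 1, 0)

/-- Second coordinate direction in the x-plane. -/
def ex1 : R3 := (EuclideanSpace.single 1 1, 0)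

/-- The z-direction. -/
def ez : R3 := (0, 1)

/-- The full Laplacian on ℝ³ = ℝ² × ℝ. -/
def lap3 {F : Type*} [NormedAddCommGroup F] [NormedSpace ℝ F]
    (f : R3 → F) (p : R3) : F :=
  pd2 ex0 f p + pd2 ex1 f p + pd2 ez f p

/-- The operator `S² f = (1−ω)f − Δf + ω² z² f` on functions on ℝ³. -/
def S2op (ω : ℝ) (f : R3 → ℂ) (p : R3) : ℂ :=
  ((1 - ω : ℝ) : ℂ) * f p - lap3 f p + ((ω ^ 2 * p.2 ^ 2 : ℝ) : ℂ) * f p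
/-- Pointwise Euclidean magnitude of the full gradient of `f`. -/
def gradMag (f : R3 → ℂ) (p : R3) : ℝ :=
  Real.sqrt (‖pd ex0 f p‖ ^ 2 + ‖pd ex1 f p‖ ^ 2 + ‖pd ez f p‖ ^ 2)

open Filter Topology

/-- Minkowski's inequality for normed groups. The specialisation of `eLpNorm_add_le` helps
unification when `G` is a space of continuous linear maps. -/
theorem eLpNorm_add_le_of_normedAddCommGroup {α G : Type*} [MeasurableSpace α]
    [NormedAddCommGroup G] {μ : Measure α} {f g : α → G} {p : ENNReal}
    (hf : AEStronglyMeasurable f μ) (hg : AEStronglyMeasurable g μ) (hp : 1 ≤ p) :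
    eLpNorm (f + g) p μ ≤ eLpNorm f p μ + eLpNorm g p μ :=
  eLpNorm_add_le hf hg hp

/-- The **Gagliardo-Nirenberg-Sobolev inequality** for `C¹` functions in `Lᵖ`, without compact support. -/
theorem eLpNorm_le_eLpNorm_fderiv_of_memLp {E F : Type*} [NormedAddCommGroup E] [NormedSpace ℝ E]
    [FiniteDimensional ℝ E] [MeasurableSpace E] [BorelSpace E] (μ : Measure E)
    [μ.IsAddHaarMeasure] [NormedAddCommGroup F] [InnerProductSpace ℝ F] {u : E → F}
    {p p' : NNReal} (hu : ContDiff ℝ 1 u) (hup : MemLp u p μ) (hp : 1 ≤ p)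
    (hn : 0 < Module.finrank ℝ E) (hp' : (p' : ℝ)⁻¹ = (p : ℝ)⁻¹ - (Module.finrank ℝ E : ℝ)⁻¹) :
    eLpNorm u p' μ ≤ eLpNormLESNormFDerivOfEqInnerConst μ p * eLpNorm (fderiv ℝ u) p μ := by
  set C := eLpNormLESNormFDerivOfEqInnerConst μ p
  let χ : ContDiffBump (0 : E) := ⟨1, 2, one_pos, one_lt_two⟩
  have hχ : ContDiff ℝ 1 χ := χ.contDiff
  obtain ⟨M, hM⟩ := (χ.hasCompactSupport.fderiv (𝕜 := ℝ)).exists_bound_of_continuous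
    (hχ.continuous_fderiv one_ne_zero)
  have hM0 : 0 ≤ M := (norm_nonneg _).trans (hM 0)
  let r : ℕ → ℝ := fun n ↦ 1 / ((n : ℝ) + 1)
  have hr0 : ∀ n, 0 < r n := fun n ↦ by positivity
  have hr : Tendsto r atTop (𝓝 0) := tendsto_one_div_add_atTop_nhds_zero_nat
  let v : ℕ → E → F := fun n x ↦ χ (r n • x) • u x
  have hcut : ∀ n, ContDiff ℝ 1 (fun x : E ↦ χ (r n • x)) := fun n ↦
    hχ.comp (contDiff_id.const_smul _)
  have hv : ∀ n, ContDiff ℝ 1 (v n) := fun n ↦ (hcut n).smul hu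
  have hvc : ∀ n, HasCompactSupport (v n) := fun n ↦
    (χ.hasCompactSupport.comp_smul (hr0 n).ne').smul_right
  have hderiv : ∀ n, eLpNorm (fderiv ℝ (v n)) p μ ≤
      eLpNorm (fderiv ℝ u) p μ + ENNReal.ofReal (r n * M) * eLpNorm u p μ := by
    intro n
    let G₁ : E → E →L[ℝ] F := fun x ↦ χ (r n • x) • fderiv ℝ u x
    let G₂ : E → E →L[ℝ] F := fun x ↦ (fderiv ℝ (fun x : E ↦ χ (r n • x)) x).smulRight (u x)
    have hfd : fderiv ℝ (v n) = G₁ + G₂ := by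
      ext1 x
      have h1 : DifferentiableAt ℝ (fun x : E ↦ χ (r n • x)) x :=
        (hcut n).differentiable one_ne_zero x
      have h2 : DifferentiableAt ℝ u x := hu.differentiable one_ne_zero x
      exact fderiv_fun_smul h1 h2
    have hG₁ : Continuous G₁ := (hcut n).continuous.smul (hu.continuous_fderiv one_ne_zero)
    have hG₂ : Continuous G₂ := by
      have := (hcut n).continuous_fderiv one_ne_zero
      have := hu.continuous
      fun_prop
    have hp1 : (1 : ENNReal) ≤ p := by exact_mod_cast hp
    have hadd : eLpNorm (G₁ + G₂) p μ ≤ eLpNorm G₁ p μ + eLpNorm G₂ p μ :=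
      eLpNorm_add_le_of_normedAddCommGroup hG₁.aestronglyMeasurable hG₂.aestronglyMeasurable hp1
    rw [hfd]
    refine hadd.trans (add_le_add ?_ ?_)
    · refine eLpNorm_mono fun x ↦ ?_
      rw [norm_smul, Real.norm_of_nonneg χ.nonneg]
      exact mul_le_of_le_one_left (norm_nonneg _) χ.le_one
    · refine eLpNorm_le_mul_eLpNorm_of_ae_le_mul (.of_forall fun x ↦ ?_) _
      rw [ContinuousLinearMap.norm_smulRight_apply]
      gcongr
      rw [fderiv_comp_smul, norm_smul, Real.norm_of_nonneg (hr0 n).le]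
      exact mul_le_mul_of_nonneg_left (hM _) (hr0 n).le
  have hlim : ∀ x, Tendsto (fun n ↦ v n x) atTop (𝓝 (u x)) := by
    intro x
    have h1 : Tendsto (fun n ↦ r n • x) atTop (𝓝 0) := by simpa using hr.smul_const x
    have h2 := (χ.continuous.tendsto 0).comp h1
    rw [χ.one_of_mem_closedBall (by simp [χ])] at h2
    simpa using h2.smul_const (u x)
  refine (Lp.eLpNorm_lim_le_liminf_eLpNorm (fun n ↦ (hv n).continuous.aestronglyMeasurable) u
    (.of_forall hlim)).trans ?_
  have hbd : Tendsto (fun n ↦ (C : ENNReal) * (eLpNorm (fderiv ℝ u) p μ +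
      ENNReal.ofReal (r n * M) * eLpNorm u p μ)) atTop
      (𝓝 (C * eLpNorm (fderiv ℝ u) p μ)) := by
    refine ENNReal.Tendsto.const_mul ?_ (.inr ENNReal.coe_ne_top)
    have h1 : Tendsto (fun n ↦ ENNReal.ofReal (r n * M)) atTop (𝓝 0) := by
      simpa using ENNReal.tendsto_ofReal (hr.mul_const M)
    simpa using (ENNReal.Tendsto.mul_const h1 (.inr hup.eLpNorm_ne_top)).const_add
      (eLpNorm (fderiv ℝ u) p μ)
  rw [← hbd.liminf_eq]
  refine liminf_le_liminf (.of_forall fun n ↦ ?_)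
  exact (eLpNorm_le_eLpNorm_fderiv_of_eq_inner μ (hv n) (hvc n) hp hn hp').trans
    (by gcongr; exact hderiv n)

/-- Abstract energy estimates for `g = S² f`, where `A`, `B`, `D` are antisymmetric (derivatives in
`x₀`, `x₁`, `z`), `Z` is symmetric (multiplication by `z`) and `[D, Z] = 1`. -/
theorem energy_estimates {V : Type*} [AddCommGroup V] [Module ℝ V] (b : V →ₗ[ℝ] V →ₗ[ℝ] ℝ)
    (hsymm : ∀ f g, b f g = b g f) (hpos : ∀ f, 0 ≤ b f f) (A B D Z : V →ₗ[ℝ] V)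
    (hA : ∀ f g, b (A f) g = -b f (A g)) (hB : ∀ f g, b (B f) g = -b f (B g))
    (hD : ∀ f g, b (D f) g = -b f (D g)) (hZ : ∀ f g, b (Z f) g = b f (Z g))
    (hAB : ∀ f, A (B f) = B (A f)) (hAD : ∀ f, A (D f) = D (A f))
    (hBD : ∀ f, B (D f) = D (B f)) (hAZ : ∀ f, A (Z f) = Z (A f))
    (hBZ : ∀ f, B (Z f) = Z (B f)) (hDZ : ∀ f, D (Z f) = Z (D f) + f)
    {ω : ℝ} (hω : 1 ≤ ω) (f g : V)
    (hg : g = (1 - ω) • f - (A (A f) + B (B f) + D (D f)) + ω ^ 2 • Z (Z f)) :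
    b (A (A f)) (A (A f)) ≤ b g g ∧ b (B (A f)) (B (A f)) ≤ b g g ∧
      b (B (B f)) (B (B f)) ≤ b g g ∧ b (D (A f)) (D (A f)) ≤ ω * b g g ∧
      b (D (B f)) (D (B f)) ≤ ω * b g g ∧ b (D (D f)) (D (D f)) ≤ 6 * ω ^ 2 * b g g := by
  obtain ⟨L, hL⟩ : ∃ L : V → V, ∀ h, L h = -A (A h) - B (B h) := ⟨_, fun _ ↦ rfl⟩
  obtain ⟨P, hP⟩ : ∃ P : V → V, ∀ h, P h = -D (D h) + ω ^ 2 • Z (Z h) := ⟨_, fun _ ↦ rfl⟩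
  obtain ⟨H, hH⟩ : ∃ H : V → V, ∀ h, H h = P h - ω • h := ⟨_, fun _ ↦ rfl⟩
  obtain ⟨a, ha⟩ : ∃ a : V → V, ∀ h, a h = D h + ω • Z h := ⟨_, fun _ ↦ rfl⟩
  have hbL : ∀ h k, b h (L k) = b (A h) (A k) + b (B h) (B k) := fun h k ↦ by
    rw [hL, hA, hB]; simp only [map_sub, map_neg]; ring
  have hbP : ∀ h k, b h (P k) = b (D h) (D k) + ω ^ 2 * b (Z h) (Z k) := fun h k ↦ by
    rw [hP, hD, hZ]; simp only [map_add, map_neg, map_smul, smul_eq_mul]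
  have hbH : ∀ h k, b h (H k) = b (a h) (a k) := fun h k ↦ by
    have h1 : b (D h) (Z k) = -b h (Z (D k)) - b h k := by
      rw [hD, hDZ, map_add]; ring
    simp only [hH, ha, map_sub, map_add, map_smul, smul_eq_mul, LinearMap.add_apply,
      LinearMap.smul_apply, hbP, h1, hZ h (D k)]
    ring
  have hAH : A (H f) = H (A f) := by
    simp only [hH, hP, map_sub, map_add, map_neg, map_smul, hAD, hAZ]
  have hBH : B (H f) = H (B f) := by
    simp only [hH, hP, map_sub, map_add, map_neg, map_smul, hBD, hBZ]
  have hLH : b (L f) (H f) = b (a (A f)) (a (A f)) + b (a (B f)) (a (B f)) := by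
    rw [hsymm, hbL, hAH, hBH, hsymm, hsymm _ (B f), hbH, hbH]
  have hgLH : g = f + L f + H f := by
    rw [hg, hL, hH, hP]; module
  have hgg : b g g = b f f + b (L f) (L f) + b (H f) (H f) +
      2 * (b (A f) (A f) + b (B f) (B f)) + 2 * b (a f) (a f) +
      2 * (b (a (A f)) (a (A f)) + b (a (B f)) (a (B f))) := by
    rw [← hLH, ← hbH f f, ← hbL, hgLH]
    simp only [map_add, LinearMap.add_apply]
    rw [hsymm (L f) f, hsymm (H f) f, hsymm (H f) (L f)]
    ring
  have hLL : b (L f) (L f) =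
      b (A (A f)) (A (A f)) + b (B (B f)) (B (B f)) + 2 * b (B (A f)) (B (A f)) := by
    have h1 : b (A (A f)) (B (B f)) = b (B (A f)) (B (A f)) := by
      rw [hA, hAB, hAB, hB (A f)]
    rw [hL]
    simp only [map_sub, map_neg, LinearMap.sub_apply, LinearMap.neg_apply]
    rw [hsymm (B (B f)) (A (A f)), h1]
    ring
  have hDk : ∀ k, b (D k) (D k) ≤ b (a k) (a k) + ω * b k k := fun k ↦ by
    have h1 := hbH k k
    rw [hH, map_sub, hbP, map_smul, smul_eq_mul] at h1
    have := mul_nonneg (sq_nonneg ω) (hpos (Z k))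
    linarith
  have hPP : b (P f) (P f) = b (D (D f)) (D (D f)) + ω ^ 4 * b (Z (Z f)) (Z (Z f)) +
      2 * ω ^ 2 * b (Z (D f)) (Z (D f)) - 2 * ω ^ 2 * b f f := by
    have h1 : 2 * b (D f) (Z f) = -b f f := by
      have h2 : b (D f) (Z f) = -b (D f) (Z f) - b f f := by
        conv_lhs => rw [hD, hDZ, map_add, ← hZ, hsymm]
        ring
      linarith
    have h3 : b (D (D f)) (Z (Z f)) = -b (Z (D f)) (Z (D f)) + b f f := by
      rw [hD, hDZ, hDZ, map_add, map_add, map_add, ← hZ (D f) (Z (D f))]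
      linarith
    rw [hP]
    simp only [map_add, map_neg, map_smul, LinearMap.add_apply, LinearMap.neg_apply,
      LinearMap.smul_apply, smul_eq_mul]
    rw [hsymm (Z (Z f)), h3]
    ring
  have hPle : b (P f) (P f) ≤ 2 * b (H f) (H f) + 2 * ω ^ 2 * b f f := by
    have h1 : P f = H f + ω • f := by rw [hH]; module
    have h2 := hpos (H f - ω • f)
    rw [h1]
    simp only [map_add, map_sub, map_smul, LinearMap.add_apply, LinearMap.sub_apply,
      LinearMap.smul_apply, smul_eq_mul] at h2 ⊢
    nlinarith
  have p1 := hpos f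
  have p2 := hpos (L f)
  have p3 := hpos (H f)
  have p4 := hpos (A f)
  have p5 := hpos (B f)
  have p6 := hpos (a f)
  have p7 := hpos (a (A f))
  have p8 := hpos (a (B f))
  have p9 := hpos (A (A f))
  have p10 := hpos (B (A f))
  have p11 := hpos (B (B f))
  have p12 := mul_nonneg (sq_nonneg ω) (hpos (Z (D f)))
  have p13 := mul_nonneg (by positivity : 0 ≤ ω ^ 4) (hpos (Z (Z f)))
  have p14 : b g g ≤ ω * b g g := le_mul_of_one_le_left (hpos g) hω
  have hω0 : 0 ≤ ω := by linarith
  have p15 : ω * (2 * b (A f) (A f)) ≤ ω * b g g := by gcongr; linarith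
  have p16 : ω * (2 * b (B f) (B f)) ≤ ω * b g g := by gcongr; linarith
  have p17 : ω ^ 2 * b f f ≤ ω ^ 2 * b g g := by gcongr; linarith
  have p18 : b g g ≤ ω ^ 2 * b g g := le_mul_of_one_le_left (hpos g) (one_le_pow₀ hω)
  refine ⟨by linarith, by linarith, by linarith, ?_, ?_, by linarith⟩
  · linarith [hDk (A f)]
  · linarith [hDk (B f)]

open scoped LineDeriv SchwartzMap

instance isAddHaarMeasure_volume_R3 : (volume : Measure R3).IsAddHaarMeasure :=
  inferInstanceAs (Measure.prod volume volume).IsAddHaarMeasure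

theorem norm_le_sum_apply_basis (L : R3 →L[ℝ] ℂ) : ‖L‖ ≤ ‖L ex0‖ + ‖L ex1‖ + ‖L ez‖ := by
  refine L.opNorm_le_bound (by positivity) fun v ↦ ?_
  have hv : v = v.1 0 • ex0 + v.1 1 • ex1 + v.2 • ez := by
    refine Prod.ext ?_ (by simp [ex0, ex1, ez])
    ext i
    fin_cases i <;> simp [ex0, ex1, ez]
  have h0 : ‖v.1 0‖ ≤ ‖v‖ := (PiLp.norm_apply_le v.1 0).trans (norm_fst_le v)
  have h1 : ‖v.1 1‖ ≤ ‖v‖ := (PiLp.norm_apply_le v.1 1).trans (norm_fst_le v)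
  have h2 : ‖v.2‖ ≤ ‖v‖ := norm_snd_le v
  calc ‖L v‖ = ‖v.1 0 • L ex0 + v.1 1 • L ex1 + v.2 • L ez‖ := by
        conv_lhs => rw [hv]
        simp only [map_add, map_smul]
    _ ≤ ‖v‖ * ‖L ex0‖ + ‖v‖ * ‖L ex1‖ + ‖v‖ * ‖L ez‖ := by
        refine (norm_add₃_le).trans ?_
        simp only [norm_smul]
        gcongr
    _ = (‖L ex0‖ + ‖L ex1‖ + ‖L ez‖) * ‖v‖ := by ring

theorem eLpNorm_le_ofReal_sum_norm_toLp {G : Type*} [NormedAddCommGroup G] (q : ENNReal)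
    [hq : Fact (1 ≤ q)] {h : R3 → G} {w₁ w₂ w₃ : 𝓢(R3, ℂ)}
    (hle : ∀ p, ‖h p‖ ≤ ‖w₁ p‖ + ‖w₂ p‖ + ‖w₃ p‖) :
    eLpNorm h q volume ≤ ENNReal.ofReal (‖w₁.toLp q‖ + ‖w₂.toLp q‖ + ‖w₃.toLp q‖) := by
  have hm : ∀ w : 𝓢(R3, ℂ), AEStronglyMeasurable (fun p ↦ ‖w p‖) volume := fun w ↦
    w.continuous.norm.aestronglyMeasurable
  have hw : ∀ w : 𝓢(R3, ℂ), eLpNorm (fun p ↦ ‖w p‖) q volume = ENNReal.ofReal ‖w.toLp q‖ :=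
    fun w ↦ by
      rw [SchwartzMap.norm_toLp, ENNReal.ofReal_toReal (w.memLp q volume).eLpNorm_ne_top, eLpNorm_norm]
  rw [ENNReal.ofReal_add (by positivity) (by positivity),
    ENNReal.ofReal_add (by positivity) (by positivity), ← hw, ← hw, ← hw]
  have h₁ : eLpNorm h q volume ≤
      eLpNorm ((fun p ↦ ‖w₁ p‖) + (fun p ↦ ‖w₂ p‖) + fun p ↦ ‖w₃ p‖) q volume :=
    eLpNorm_mono_real hle
  refine h₁.trans ((eLpNorm_add_le ((hm _).add (hm _)) (hm _) hq.out).trans ?_)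
  gcongr
  exact eLpNorm_add_le (hm _) (hm _) hq.out

/-- The Sobolev embedding `H¹ ⊂ L⁶` for Schwartz functions on `ℝ³`. -/
theorem exists_norm_toLp_six_le : ∃ C : ℝ, 0 ≤ C ∧ ∀ u : 𝓢(R3, ℂ),
    ‖u.toLp 6‖ ≤ C * (‖(∂_{ex0} u).toLp 2‖ + ‖(∂_{ex1} u).toLp 2‖ + ‖(∂_{ez} u).toLp 2‖) := by
  refine ⟨eLpNormLESNormFDerivOfEqInnerConst (volume : Measure R3) (2 : NNReal), NNReal.coe_nonneg _,
    fun u ↦ ?_⟩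
  have hrank : Module.finrank ℝ R3 = 3 := by simp [R3, R2]
  have h1 := eLpNorm_le_eLpNorm_fderiv_of_memLp (volume : Measure R3) (p := 2) (p' := 6)
    (u.smooth 1) (u.memLp _) one_le_two (by rw [hrank]; norm_num) (by rw [hrank]; norm_num)
  simp only [ENNReal.coe_ofNat] at h1
  have h2 : eLpNorm (fderiv ℝ u) 2 volume ≤ ENNReal.ofReal
      (‖(∂_{ex0} u).toLp 2‖ + ‖(∂_{ex1} u).toLp 2‖ + ‖(∂_{ez} u).toLp 2‖) :=
    eLpNorm_le_ofReal_sum_norm_toLp 2 fun p ↦ by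
      simpa only [SchwartzMap.lineDerivOp_apply_eq_fderiv] using
        norm_le_sum_apply_basis (fderiv ℝ u p)
  have h3 := ENNReal.toReal_mono
    (ENNReal.mul_ne_top ENNReal.coe_ne_top ENNReal.ofReal_ne_top) (h1.trans (mul_le_mul_right h2 _))
  rwa [ENNReal.toReal_mul, ENNReal.toReal_ofReal (by positivity), ENNReal.coe_toReal,
    ← SchwartzMap.norm_toLp] at h3

/-- The Sobolev inequality rescaled by the factor `c` in the `z`-direction. -/
theorem exists_norm_toLp_six_le_anisotropic : ∃ C : ℝ, 0 ≤ C ∧ ∀ c : ℝ, 0 < c → ∀ u : 𝓢(R3, ℂ),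
    c ^ (1 / 6 : ℝ) * ‖u.toLp 6‖ ≤ C * (c ^ (1 / 2 : ℝ) *
      (‖(∂_{ex0} u).toLp 2‖ + ‖(∂_{ex1} u).toLp 2‖ + c⁻¹ * ‖(∂_{ez} u).toLp 2‖)) := by
  obtain ⟨C, hC, hSob⟩ := exists_norm_toLp_six_le
  refine ⟨C, hC, fun c hc u ↦ ?_⟩
  let A : R3 ≃L[ℝ] R3 := (ContinuousLinearEquiv.refl ℝ R2).prodCongr
    (ContinuousLinearEquiv.unitsEquivAut ℝ (Units.mk0 c⁻¹ (inv_ne_zero hc.ne')))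
  have hA : ∀ p, A p = (p.1, c⁻¹ * p.2) := fun p ↦ by simp [A, mul_comm]
  have hmap : Measure.map A (volume : Measure R3) = ENNReal.ofReal c • volume := by
    have h1 : (A : R3 → R3) = Prod.map id (c⁻¹ * ·) := funext hA
    rw [h1, Measure.volume_eq_prod,
      ← Measure.map_prod_map _ _ measurable_id (measurable_const_mul _), Measure.map_id,
      Real.map_volume_mul_left (inv_ne_zero hc.ne'), inv_inv, abs_of_pos hc,
      Measure.prod_smul_right]
  have hnorm : ∀ (w : 𝓢(R3, ℂ)) (q : ENNReal), q ≠ ⊤ →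
      ‖(SchwartzMap.compCLMOfContinuousLinearEquiv ℝ A w).toLp q‖ =
        c ^ (1 / q).toReal * ‖w.toLp q‖ := fun w q hq ↦ by
    rw [SchwartzMap.norm_toLp, SchwartzMap.norm_toLp,
      SchwartzMap.compCLMOfContinuousLinearEquiv_apply,
      ← eLpNorm_map_measure w.continuous.aestronglyMeasurable A.continuous.aemeasurable, hmap,
      eLpNorm_smul_measure_of_ne_top hq, smul_eq_mul, ENNReal.toReal_mul,
      ← ENNReal.toReal_rpow, ENNReal.toReal_ofReal hc.le]
  have h := hSob (SchwartzMap.compCLMOfContinuousLinearEquiv ℝ A u)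
  have h0 : A ex0 = ex0 := by simp [hA, ex0]
  have h1 : A ex1 = ex1 := by simp [hA, ex1]
  have h2 : A ez = c⁻¹ • ez := by simp [hA, ez]
  have h3 : ‖((c⁻¹ • ∂_{ez} u : 𝓢(R3, ℂ))).toLp 2‖ = c⁻¹ * ‖(∂_{ez} u).toLp 2‖ := by
    change ‖SchwartzMap.toLpCLM ℝ ℂ 2 volume (c⁻¹ • ∂_{ez} u)‖ = _
    rw [map_smul, norm_smul, Real.norm_of_nonneg (inv_pos.2 hc).le]
    rfl
  have e6 : (1 / 6 : ENNReal).toReal = 1 / 6 := by simp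
  have e2 : (1 / 2 : ENNReal).toReal = 1 / 2 := by simp
  rw [SchwartzMap.lineDerivOp_compCLMOfContinuousLinearEquiv,
    SchwartzMap.lineDerivOp_compCLMOfContinuousLinearEquiv,
    SchwartzMap.lineDerivOp_compCLMOfContinuousLinearEquiv, h0, h1, h2,
    LineDeriv.lineDerivOp_left_smul, hnorm _ 6 (by simp), hnorm _ 2 (by simp),
    hnorm _ 2 (by simp), hnorm _ 2 (by simp), h3, e6, e2] at h
  linarith

/-- Directional derivatives of Schwartz functions commute. -/
theorem SchwartzMap.lineDerivOp_comm {E F : Type*} [NormedAddCommGroup E] [NormedSpace ℝ E]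
    [NormedAddCommGroup F] [NormedSpace ℝ F] (v w : E) (f : 𝓢(E, F)) :
    ∂_{v} (∂_{w} f) = ∂_{w} (∂_{v} f) := by
  have h : ∀ (a b : E) (x : E),
      (∂_{a} (∂_{b} f)) x = fderiv ℝ (fderiv ℝ f) x a b := fun a b x ↦ by
    have h1 : ⇑(∂_{b} f : 𝓢(E, F)) = fun y ↦ fderiv ℝ f y b :=
      funext fun y ↦ SchwartzMap.lineDerivOp_apply_eq_fderiv b f y
    have h2 : DifferentiableAt ℝ (fderiv ℝ f) x :=
      ((f.smooth 2).fderiv_right (m := 1) le_rfl).differentiable one_ne_zero x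
    rw [SchwartzMap.lineDerivOp_apply_eq_fderiv, h1, fderiv_clm_apply h2 (by fun_prop)]
    simp
  ext x
  rw [h, h]
  exact ((f.smooth 2).contDiffAt.isSymmSndFDerivAt (by simp)) v w

/-- Multiplication by the coordinate `z`. -/
def mulZ : 𝓢(R3, ℂ) →ₗ[ℝ] 𝓢(R3, ℂ) :=
  (SchwartzMap.smulLeftCLM ℂ (fun p : R3 ↦ p.2)).toLinearMap

theorem mulZ_apply (f : 𝓢(R3, ℂ)) (p : R3) : mulZ f p = p.2 • f p :=
  SchwartzMap.smulLeftCLM_apply_apply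
    (ContinuousLinearMap.snd ℝ R2 ℝ).hasTemperateGrowth f p

theorem lineDerivOp_mulZ (v : R3) (f : 𝓢(R3, ℂ)) :
    ∂_{v} (mulZ f) = mulZ (∂_{v} f) + v.2 • f := by
  ext p
  have h1 : ⇑(mulZ f) = fun q : R3 ↦ q.2 • f q := funext (mulZ_apply f)
  have h2 : fderiv ℝ (fun q : R3 ↦ q.2) p = ContinuousLinearMap.snd ℝ R2 ℝ := fderiv_snd
  rw [SchwartzMap.lineDerivOp_apply_eq_fderiv, h1,
    fderiv_fun_smul (by fun_prop) f.differentiableAt, h2]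
  simp [mulZ_apply, SchwartzMap.lineDerivOp_apply_eq_fderiv]

/-- The real `L²` pairing of Schwartz functions. -/
def l2Pairing : 𝓢(R3, ℂ) →ₗ[ℝ] 𝓢(R3, ℂ) →ₗ[ℝ] ℝ :=
  (innerₗ (Lp ℂ 2 (volume : Measure R3))).compl₁₂
    (SchwartzMap.toLpCLM ℝ ℂ 2 volume).toLinearMap
    (SchwartzMap.toLpCLM ℝ ℂ 2 volume).toLinearMap

theorem l2Pairing_self (f : 𝓢(R3, ℂ)) : l2Pairing f f = ‖f.toLp 2‖ ^ 2 :=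
  real_inner_self_eq_norm_sq (f.toLp 2 volume)

theorem l2Pairing_comm (f g : 𝓢(R3, ℂ)) : l2Pairing f g = l2Pairing g f :=
  real_inner_comm (g.toLp 2 volume) (f.toLp 2 volume)

theorem l2Pairing_eq_integral (f g : 𝓢(R3, ℂ)) :
    l2Pairing f g = ∫ p, inner ℝ (f p) (g p) := by
  change inner ℝ (f.toLp 2 volume) (g.toLp 2 volume) = _
  rw [L2.inner_def]
  refine integral_congr_ae ?_
  filter_upwards [f.coeFn_toLp 2 volume, g.coeFn_toLp 2 volume] with p h1 h2
  rw [h1, h2]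

theorem l2Pairing_lineDerivOp (v : R3) (f g : 𝓢(R3, ℂ)) :
    l2Pairing (∂_{v} f) g = -l2Pairing f (∂_{v} g) := by
  have h := SchwartzMap.integral_bilinear_lineDerivOp_right_eq_neg_left (μ := volume) f g
    (innerSL ℝ) v
  rw [l2Pairing_eq_integral, l2Pairing_eq_integral]
  exact neg_eq_iff_eq_neg.1 h.symm

theorem l2Pairing_mulZ (f g : 𝓢(R3, ℂ)) : l2Pairing (mulZ f) g = l2Pairing f (mulZ g) := by
  simp only [l2Pairing_eq_integral, mulZ_apply, real_inner_smul_left, real_inner_smul_right]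

theorem pd_eq_lineDerivOp (v : R3) (f : 𝓢(R3, ℂ)) : pd v f = ∂_{v} f :=
  funext fun p ↦ (SchwartzMap.lineDerivOp_apply_eq_fderiv v f p).symm

/-- The operator `S²` acting on Schwartz functions. -/
def S2Schwartz (ω : ℝ) (f : 𝓢(R3, ℂ)) : 𝓢(R3, ℂ) :=
  (1 - ω) • f - (∂_{ex0} (∂_{ex0} f) + ∂_{ex1} (∂_{ex1} f) + ∂_{ez} (∂_{ez} f)) +
    ω ^ 2 • mulZ (mulZ f)

theorem S2op_eq (ω : ℝ) (f : 𝓢(R3, ℂ)) : S2op ω f = S2Schwartz ω f := by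
  funext p
  simp only [S2op, S2Schwartz, lap3, pd2, pd_eq_lineDerivOp, add_apply,
    sub_apply, smul_apply, mulZ_apply, Complex.real_smul]
  push_cast
  ring

/-- The `L²` bounds for second derivatives in terms of `S²f`. -/
theorem norm_second_derivs_le {ω : ℝ} (hω : 1 ≤ ω) (f : 𝓢(R3, ℂ)) :
    ‖(∂_{ex0} (∂_{ex0} f)).toLp 2‖ ≤ ‖(S2Schwartz ω f).toLp 2‖ ∧
    ‖(∂_{ex1} (∂_{ex0} f)).toLp 2‖ ≤ ‖(S2Schwartz ω f).toLp 2‖ ∧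
    ‖(∂_{ex1} (∂_{ex1} f)).toLp 2‖ ≤ ‖(S2Schwartz ω f).toLp 2‖ ∧
    ‖(∂_{ez} (∂_{ex0} f)).toLp 2‖ ≤ ω ^ (1 / 2 : ℝ) * ‖(S2Schwartz ω f).toLp 2‖ ∧
    ‖(∂_{ez} (∂_{ex1} f)).toLp 2‖ ≤ ω ^ (1 / 2 : ℝ) * ‖(S2Schwartz ω f).toLp 2‖ ∧
    ‖(∂_{ez} (∂_{ez} f)).toLp 2‖ ≤ 3 * ω * ‖(S2Schwartz ω f).toLp 2‖ := by
  have hω0 : 0 ≤ ω := by linarith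
  let D : R3 → 𝓢(R3, ℂ) →ₗ[ℝ] 𝓢(R3, ℂ) := fun v ↦
    (LineDeriv.lineDerivOpCLM ℝ 𝓢(R3, ℂ) v).toLinearMap
  obtain ⟨h1, h2, h3, h4, h5, h6⟩ := energy_estimates l2Pairing l2Pairing_comm
    (fun f ↦ by rw [l2Pairing_self]; positivity) (D ex0) (D ex1) (D ez) mulZ
    (l2Pairing_lineDerivOp ex0) (l2Pairing_lineDerivOp ex1) (l2Pairing_lineDerivOp ez)
    l2Pairing_mulZ (SchwartzMap.lineDerivOp_comm ex0 ex1) (SchwartzMap.lineDerivOp_comm ex0 ez)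
    (SchwartzMap.lineDerivOp_comm ex1 ez)
    (fun f ↦ (lineDerivOp_mulZ ex0 f).trans (by simp [D, ex0]))
    (fun f ↦ (lineDerivOp_mulZ ex1 f).trans (by simp [D, ex1]))
    (fun f ↦ (lineDerivOp_mulZ ez f).trans (by simp [D, ez])) hω f (S2Schwartz ω f) rfl
  simp only [l2Pairing_self] at h1 h2 h3 h4 h5 h6
  have hs : (ω ^ (1 / 2 : ℝ)) ^ 2 = ω := by
    rw [← Real.sqrt_eq_rpow, Real.sq_sqrt hω0]
  refine ⟨?_, ?_, ?_, ?_, ?_, ?_⟩ <;>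
    refine (sq_le_sq₀ (norm_nonneg _) (by positivity)).1 ?_
  · exact h1
  · exact h2
  · exact h3
  · rw [mul_pow, hs]; exact h4
  · rw [mul_pow, hs]; exact h5
  · refine h6.trans ?_
    rw [mul_pow, mul_pow]
    gcongr
    norm_num

theorem eLpNorm_gradMag_le (f : 𝓢(R3, ℂ)) :
    (eLpNorm (gradMag f) 6 volume).toReal ≤
      ‖(∂_{ex0} f).toLp 6‖ + ‖(∂_{ex1} f).toLp 6‖ + ‖(∂_{ez} f).toLp 6‖ := by
  have : Fact ((1 : ENNReal) ≤ 6) := ⟨by norm_num⟩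
  refine ENNReal.toReal_le_of_le_ofReal (by positivity)
    (eLpNorm_le_ofReal_sum_norm_toLp 6 fun p ↦ ?_)
  rw [gradMag, Real.norm_of_nonneg (Real.sqrt_nonneg _)]
  simp only [pd_eq_lineDerivOp]
  refine Real.sqrt_le_iff.2 ⟨by positivity, ?_⟩
  nlinarith [mul_nonneg (norm_nonneg ((∂_{ex0} f : 𝓢(R3, ℂ)) p))
      (norm_nonneg ((∂_{ex1} f : 𝓢(R3, ℂ)) p)),
    mul_nonneg (norm_nonneg ((∂_{ex0} f : 𝓢(R3, ℂ)) p)) (norm_nonneg ((∂_{ez} f : 𝓢(R3, ℂ)) p)),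
    mul_nonneg (norm_nonneg ((∂_{ex1} f : 𝓢(R3, ℂ)) p)) (norm_nonneg ((∂_{ez} f : 𝓢(R3, ℂ)) p))]

/-- there is `C > 0` such that for every `ω ≥ 1` and every Schwartz
function `f` on ℝ³, `‖∇f‖_{L⁶} ≤ C ω^{2/3} ‖S²f‖_{L²}`. -/
theorem gradient_L6_bound :
    ∃ C : ℝ, 0 < C ∧ ∀ ω : ℝ, 1 ≤ ω → ∀ f : SchwartzMap R3 ℂ,
      (eLpNorm (gradMag (⇑f)) 6 volume).toReal ≤
        C * ω ^ ((2 : ℝ) / 3) * (eLpNorm (S2op ω (⇑f)) 2 volume).toReal := by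
  obtain ⟨C, hC, hSob⟩ := exists_norm_toLp_six_le_anisotropic
  refine ⟨11 * C + 1, by positivity, fun ω hω f ↦ (eLpNorm_gradMag_le f).trans ?_⟩
  obtain ⟨h1, h2, h3, h4, h5, h6⟩ := norm_second_derivs_le hω f
  rw [S2op_eq, ← SchwartzMap.norm_toLp]
  set N := ‖(S2Schwartz ω f).toLp 2‖
  have hN : 0 ≤ N := norm_nonneg _
  have hω0 : 0 < ω := by linarith
  have hω1 : 1 ≤ ω ^ (2 / 3 : ℝ) := Real.one_le_rpow hω (by norm_num)
  have hω2 : ω ^ (1 / 2 : ℝ) ≤ ω ^ (2 / 3 : ℝ) := Real.rpow_le_rpow_of_exponent_le hω (by norm_num)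
  have hN1 : N ≤ ω ^ (2 / 3 : ℝ) * N := le_mul_of_one_le_left hN hω1
  have hN2 : ω ^ (1 / 2 : ℝ) * N ≤ ω ^ (2 / 3 : ℝ) * N := by gcongr
  have hx : ‖(∂_{ex0} f).toLp 6‖ ≤ C * (3 * (ω ^ (2 / 3 : ℝ) * N)) := by
    have h := hSob 1 one_pos (∂_{ex0} f)
    simp only [Real.one_rpow, one_mul, inv_one] at h
    exact h.trans (by gcongr; linarith)
  have hy : ‖(∂_{ex1} f).toLp 6‖ ≤ C * (3 * (ω ^ (2 / 3 : ℝ) * N)) := by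
    have h := hSob 1 one_pos (∂_{ex1} f)
    simp only [Real.one_rpow, one_mul, inv_one] at h
    rw [SchwartzMap.lineDerivOp_comm ex0 ex1] at h
    exact h.trans (by gcongr; linarith)
  have hz : ‖(∂_{ez} f).toLp 6‖ ≤ C * (5 * (ω ^ (2 / 3 : ℝ) * N)) := by
    have h := hSob (ω ^ (1 / 2 : ℝ)) (by positivity) (∂_{ez} f)
    rw [SchwartzMap.lineDerivOp_comm ex0 ez, SchwartzMap.lineDerivOp_comm ex1 ez,
      ← Real.rpow_mul hω0.le, ← Real.rpow_mul hω0.le, ← Real.rpow_neg hω0.le] at h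
    have h7 : ω ^ (-(1 / 2) : ℝ) * ‖(∂_{ez} (∂_{ez} f)).toLp 2‖ ≤
        3 * (ω ^ (1 / 2 : ℝ) * N) := by
      have h8 : ω ^ (-(1 / 2) : ℝ) * ω = ω ^ (1 / 2 : ℝ) := by
        rw [← Real.rpow_add_one hω0.ne']; norm_num
      calc _ ≤ ω ^ (-(1 / 2) : ℝ) * (3 * ω * N) := by gcongr
        _ = 3 * ((ω ^ (-(1 / 2) : ℝ) * ω) * N) := by ring
        _ = _ := by rw [h8]
    have h9 : ω ^ (1 / 2 * (1 / 2) : ℝ) * ω ^ (1 / 2 : ℝ) =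
        ω ^ (1 / 2 * (1 / 6) : ℝ) * ω ^ (2 / 3 : ℝ) := by
      rw [← Real.rpow_add hω0, ← Real.rpow_add hω0]; norm_num
    refine le_of_mul_le_mul_left (h.trans ?_) (by positivity : 0 < ω ^ (1 / 2 * (1 / 6) : ℝ))
    calc _ ≤ C * (ω ^ (1 / 2 * (1 / 2) : ℝ) * (5 * (ω ^ (1 / 2 : ℝ) * N))) := by
          gcongr; linarith
      _ = C * (5 * ((ω ^ (1 / 2 * (1 / 2) : ℝ) * ω ^ (1 / 2 : ℝ)) * N)) := by ring
      _ = _ := by rw [h9]; ring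
  have hpos : 0 ≤ ω ^ (2 / 3 : ℝ) * N := by positivity
  linarith
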